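/- arXiv:1703.10839 — 2 statements merged into one kernel-verified Lean document; each statement's English description precedes it below -/
import Mathlib

section
/- Let A be the heart of a bounded t-structure on a triangulated category D, and let (T, F) be a torsion pair on A, i.e. Hom(T,F) = 0 for all T ∈ T, F ∈ F, and every A ∈ A fits in a short exact sequence 0 → T → A → F → 0 with T ∈ T, F ∈ F. Then the extension closure A' = ⟨T, F[1]⟩ is again the heart of a bounded t-structure on D. -/
open CategoryTheory Limits Pretriangulated

universe v u

variable {C : Type u} [Category.{v} C] [Preadditive C] [HasZeroObject C]
  [HasShift C ℤ] [∀ n : ℤ, (shiftFunctor C n).Additive] [Pretriangulated C]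

/-- A full subcategory (given by a set of objects) is the heart of a bounded
t-structure: negative self-Homs vanish, and every object admits a finite
filtration whose cones are shifts `Aᵢ⟦kᵢ⟧` of objects `Aᵢ` of the subcategory,
with strictly decreasing shifts `kᵢ`. -/
def IsHeart (S : Set C) : Prop :=
  (∀ E ∈ S, ∀ F ∈ S, ∀ n : ℤ, n < 0 → ∀ f : E ⟶ F⟦n⟧, f = 0) ∧
  (∀ G : C, ∃ (m : ℕ) (X : Fin (m + 1) → C)
      (f : ∀ i : Fin m, X i.castSucc ⟶ X i.succ)
      (k : Fin m → ℤ) (A : Fin m → C),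
      IsZero (X 0) ∧ Nonempty (X (Fin.last m) ≅ G) ∧ StrictAnti k ∧
      (∀ i, A i ∈ S) ∧
      (∀ i : Fin m, ∃ (g : X i.succ ⟶ (A i)⟦k i⟧)
          (h : (A i)⟦k i⟧ ⟶ (X i.castSucc)⟦(1 : ℤ)⟧),
          Triangle.mk (f i) g h ∈ distTriang C))

/-- The extension closure of a set of objects in a triangulated category. -/
inductive ExtClosed (S : Set C) : C → Prop
  | of (X : C) (h : X ∈ S) : ExtClosed S X
  | zero (X : C) (h : IsZero X) : ExtClosed S X
  | ext (X E Z : C) (g : X ⟶ E) (h : E ⟶ Z) (w : Z ⟶ X⟦(1 : ℤ)⟧)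
      (hT : Triangle.mk g h w ∈ distTriang C)
      (hX : ExtClosed S X) (hZ : ExtClosed S Z) : ExtClosed S E

/-- Every morphism from `X` to `Y` is zero. -/
def NoHom (X Y : C) : Prop := ∀ f : X ⟶ Y, f = 0

/-- `Y` is an extension of `Z` by `X`. -/
def IsExtension (X Y Z : C) : Prop :=
  ∃ (f : X ⟶ Y) (g : Y ⟶ Z) (h : Z ⟶ X⟦(1 : ℤ)⟧), Triangle.mk f g h ∈ distTriang C

section Triangle

variable {X Y Z N : C} {f : X ⟶ Y} {g : Y ⟶ Z} {w : Z ⟶ X⟦(1 : ℤ)⟧}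

lemma exists_desc_mor₂ (hT : Triangle.mk f g w ∈ distTriang C) (a : Y ⟶ N) (ha : f ≫ a = 0) :
    ∃ b : Z ⟶ N, a = g ≫ b :=
  Triangle.yoneda_exact₂ (Triangle.mk f g w) hT a ha

lemma exists_desc_mor₃ (hT : Triangle.mk f g w ∈ distTriang C) (a : Z ⟶ N) (ha : g ≫ a = 0) :
    ∃ b : X⟦(1 : ℤ)⟧ ⟶ N, a = w ≫ b :=
  Triangle.yoneda_exact₃ (Triangle.mk f g w) hT a ha

lemma exists_lift_mor₁ (hT : Triangle.mk f g w ∈ distTriang C) (a : N ⟶ Y) (ha : a ≫ g = 0) :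
    ∃ b : N ⟶ X, a = b ≫ f :=
  Triangle.coyoneda_exact₂ (Triangle.mk f g w) hT a ha

lemma exists_lift_mor₃ (hT : Triangle.mk f g w ∈ distTriang C) (a : N ⟶ X⟦(1 : ℤ)⟧)
    (ha : a ≫ f⟦(1 : ℤ)⟧' = 0) : ∃ b : N ⟶ Z, a = b ≫ w :=
  Triangle.coyoneda_exact₁ (Triangle.mk f g w) hT a ha

lemma exists_desc_mor₁ (hT : Triangle.mk f g w ∈ distTriang C) (a : X ⟶ N)
    (ha : w ≫ a⟦(1 : ℤ)⟧' = 0) : ∃ b : Y ⟶ N, a = f ≫ b := by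
  obtain ⟨b, hb⟩ : ∃ b : Y⟦(1 : ℤ)⟧ ⟶ N⟦(1 : ℤ)⟧, a⟦(1 : ℤ)⟧' = (-f⟦(1 : ℤ)⟧') ≫ b :=
    exists_desc_mor₃ (rot_of_distTriang _ hT) (a⟦(1 : ℤ)⟧') ha
  obtain ⟨b, rfl⟩ := (shiftFunctor C (1 : ℤ)).map_surjective b
  refine ⟨-b, (shiftFunctor C (1 : ℤ)).map_injective ?_⟩
  rw [hb, Preadditive.comp_neg, Functor.map_neg, Functor.map_comp, Preadditive.neg_comp]

end Triangle

section NoHom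

set_option linter.unusedSectionVars false

lemma NoHom.of_iso {X X' Y Y' : C} (h : NoHom X Y) (eX : X ≅ X') (eY : Y ≅ Y') :
    NoHom X' Y' := fun f => by
  have := h (eX.hom ≫ f ≫ eY.inv)
  simpa using this

lemma NoHom.shift {X Y : C} (h : NoHom X Y) (a : ℤ) : NoHom (X⟦a⟧) (Y⟦a⟧) := fun f => by
  obtain ⟨g, rfl⟩ := (shiftFunctor C a).map_surjective f
  rw [h g, Functor.map_zero]

lemma NoHom.shift' {X Y : C} {b : ℤ} (h : NoHom X (Y⟦b⟧)) (a c : ℤ) (hc : b + a = c) :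
    NoHom (X⟦a⟧) (Y⟦c⟧) :=
  (h.shift a).of_iso (Iso.refl _) ((shiftFunctorAdd' C b a c hc).app Y).symm

lemma IsExtension.noHom_right {X Y Z N : C} (h : IsExtension X Y Z)
    (hX : NoHom N X) (hZ : NoHom N Z) : NoHom N Y := fun a => by
  obtain ⟨f, g, w, hT⟩ := h
  obtain ⟨b, rfl⟩ := exists_lift_mor₁ hT a (hZ _)
  rw [hX b, zero_comp]

lemma IsExtension.noHom_left {X Y Z N : C} (h : IsExtension X Y Z)
    (hX : NoHom X N) (hZ : NoHom Z N) : NoHom Y N := fun a => by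
  obtain ⟨f, g, w, hT⟩ := h
  obtain ⟨b, rfl⟩ := exists_desc_mor₂ hT a (hX _)
  rw [hZ b, comp_zero]

end NoHom

section IsExtension

lemma IsExtension.of_iso {X X' Y Y' Z Z' : C} (h : IsExtension X Y Z)
    (eX : X ≅ X') (eY : Y ≅ Y') (eZ : Z ≅ Z') : IsExtension X' Y' Z' := by
  obtain ⟨f, g, w, hT⟩ := h
  refine ⟨eX.inv ≫ f ≫ eY.hom, eY.inv ≫ g ≫ eZ.hom, eZ.inv ≫ w ≫ eX.hom⟦1⟧',
    isomorphic_distinguished _ hT _ ?_⟩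
  refine Triangle.isoMk _ _ eX.symm eY.symm eZ.symm ?_ ?_ ?_
  · exact (by simp : (eX.inv ≫ f ≫ eY.hom) ≫ eY.inv = eX.inv ≫ f)
  · exact (by simp : (eY.inv ≫ g ≫ eZ.hom) ≫ eZ.inv = eY.inv ≫ g)
  · exact (by simp [← Functor.map_comp] :
      (eZ.inv ≫ w ≫ eX.hom⟦(1 : ℤ)⟧') ≫ eX.inv⟦(1 : ℤ)⟧' = eZ.inv ≫ w)

lemma IsExtension.shift {X Y Z : C} (h : IsExtension X Y Z) (n : ℤ) :
    IsExtension (X⟦n⟧) (Y⟦n⟧) (Z⟦n⟧) := by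
  obtain ⟨f, g, w, hT⟩ := h
  exact ⟨_, _, _, Triangle.shift_distinguished _ hT n⟩

end IsExtension

section Triangle

variable {X Y Z N : C} {f : X ⟶ Y} {g : Y ⟶ Z} {w : Z ⟶ X⟦(1 : ℤ)⟧}

lemma NoHom.eq_zero_of_comp_mor₁ (hT : Triangle.mk f g w ∈ distTriang C)
    (hN : NoHom (N⟦(1 : ℤ)⟧) Z) {a : N ⟶ X} (ha : a ≫ f = 0) : a = 0 := by
  obtain ⟨b, hb⟩ := exists_lift_mor₃ hT (a⟦(1 : ℤ)⟧')
    (by rw [← Functor.map_comp, ha, Functor.map_zero])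
  apply (shiftFunctor C (1 : ℤ)).map_injective
  rw [hb, hN b, zero_comp, Functor.map_zero]

lemma NoHom.eq_zero_of_mor₂_comp (hT : Triangle.mk f g w ∈ distTriang C)
    (hN : NoHom (X⟦(1 : ℤ)⟧) N) {a : Z ⟶ N} (ha : g ≫ a = 0) : a = 0 := by
  obtain ⟨b, rfl⟩ := exists_desc_mor₃ hT a ha
  rw [hN b, comp_zero]

lemma NoHom.eq_zero_of_mor₃_comp (hT : Triangle.mk f g w ∈ distTriang C)
    (hN : NoHom (Y⟦(1 : ℤ)⟧) N) {a : X⟦(1 : ℤ)⟧ ⟶ N} (ha : w ≫ a = 0) : a = 0 :=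
  NoHom.eq_zero_of_mor₂_comp (rot_of_distTriang _ hT) hN ha

end Triangle

/-- A form of the octahedral axiom which, thanks to the vanishing of some morphisms,
holds in any pretriangulated category: iterated extensions are associative. -/
lemma IsExtension.assoc_of_noHom {X Y Z P Q : C} (h₁ : IsExtension X Y P)
    (h₂ : IsExtension Y Z Q) (hXP : NoHom X P) (hXQ : NoHom X Q)
    (hXP' : NoHom (X⟦(1 : ℤ)⟧) P) (hXQ' : NoHom (X⟦(1 : ℤ)⟧) Q)
    (hPP : NoHom (P⟦(1 : ℤ)⟧) P) (hPQ : NoHom (P⟦(1 : ℤ)⟧) Q)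
    (hQP : NoHom (Q⟦(1 : ℤ)⟧) P) (hQQ : NoHom (Q⟦(1 : ℤ)⟧) Q) :
    ∃ W, IsExtension P W Q ∧ IsExtension X Z W := by
  have h₁' := h₁
  have h₂' := h₂
  obtain ⟨u, c, x, hT₁⟩ := h₁
  obtain ⟨g, d, y, hT₂⟩ := h₂
  obtain ⟨W, a, b, hT₃⟩ := distinguished_cocone_triangle₂ (y ≫ c⟦(1 : ℤ)⟧')
  have hW : IsExtension P W Q := ⟨_, _, _, hT₃⟩
  refine ⟨W, hW, ?_⟩
  have hXW : NoHom X W := hW.noHom_right hXP hXQ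
  have hXW' : NoHom (X⟦(1 : ℤ)⟧) W := hW.noHom_right hXP' hXQ'
  have hYW' : NoHom (Y⟦(1 : ℤ)⟧) W :=
    (h₁'.shift 1).noHom_left hXW' (hW.noHom_right hPP hPQ)
  have hZW' : NoHom (Z⟦(1 : ℤ)⟧) W :=
    (h₂'.shift 1).noHom_left hYW' (hW.noHom_right hQP hQQ)
  obtain ⟨φ, hφ₁, hφ₂⟩ : ∃ φ : Z ⟶ W, g ≫ φ = c ≫ a ∧ d = φ ≫ b := by
    obtain ⟨φ, hφ₁, hφ₂⟩ := complete_distinguished_triangle_morphism₂ _ _ hT₂ hT₃ c (𝟙 Q)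
      (Category.id_comp _).symm
    exact ⟨φ, hφ₁, (Category.comp_id d).symm.trans hφ₂⟩
  have hepi : ∀ e : W ⟶ W, φ ≫ e = 0 → e = 0 := by
    intro e he
    have hae : a ≫ e = 0 := by
      refine NoHom.eq_zero_of_mor₂_comp hT₁ hXW' ?_
      rw [← Category.assoc, ← hφ₁, Category.assoc, he, comp_zero]
    obtain ⟨e', rfl⟩ := exists_desc_mor₂ hT₃ e hae
    rw [NoHom.eq_zero_of_mor₂_comp hT₂ hYW' (a := e')
      (by rw [hφ₂, Category.assoc]; exact he), comp_zero]
  obtain ⟨V, v, q, hT₄⟩ := distinguished_cocone_triangle₁ φ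
  obtain ⟨r, hr⟩ := exists_lift_mor₁ hT₄ (u ≫ g) (hXW _)
  have hvφ : v ≫ φ = 0 := comp_distTriang_mor_zero₁₂ _ hT₄
  obtain ⟨t, ht⟩ := exists_lift_mor₁ hT₂ v (by
    rw [hφ₂, ← Category.assoc, hvφ, zero_comp])
  -- the lift `t` is corrected so as to factor through `u`
  obtain ⟨l, hl⟩ : ∃ l : V⟦(1 : ℤ)⟧ ⟶ Q,
      (t ≫ c)⟦(1 : ℤ)⟧' = l ≫ y ≫ c⟦(1 : ℤ)⟧' := by
    refine exists_lift_mor₃ hT₃ ((t ≫ c)⟦(1 : ℤ)⟧') ?_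
    rw [← Functor.map_comp, Category.assoc, ← hφ₁, ← Category.assoc, ← ht, hvφ,
      Functor.map_zero]
  obtain ⟨t', ht'⟩ := (shiftFunctor C (1 : ℤ)).map_surjective (l ≫ y)
  have ht'c : t' ≫ c = t ≫ c := by
    apply (shiftFunctor C (1 : ℤ)).map_injective
    rw [hl, Functor.map_comp, ht', Category.assoc]
  have ht'g : t' ≫ g = 0 := by
    apply (shiftFunctor C (1 : ℤ)).map_injective
    have hyg : y ≫ g⟦(1 : ℤ)⟧' = 0 := comp_distTriang_mor_zero₃₁ _ hT₂
    rw [Functor.map_comp, ht', Category.assoc, hyg, comp_zero, Functor.map_zero]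
  obtain ⟨s, hs⟩ := exists_lift_mor₁ hT₁ (t - t') (by
    rw [Preadditive.sub_comp, ht'c, sub_self])
  have hsv : s ≫ u ≫ g = v := by
    rw [← Category.assoc, ← hs, Preadditive.sub_comp, ht'g, sub_zero, ht]
  have hrs : r ≫ s = 𝟙 X := by
    rw [← sub_eq_zero]
    refine NoHom.eq_zero_of_comp_mor₁ hT₁ hXP' (NoHom.eq_zero_of_comp_mor₁ hT₂ hXQ' ?_)
    simp [Preadditive.sub_comp, hsv, ← hr]
  have hVW : NoHom (V⟦(1 : ℤ)⟧) W := by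
    intro e
    refine NoHom.eq_zero_of_mor₃_comp hT₄ hZW' (hepi _ ?_)
    have : φ ≫ q = 0 := comp_distTriang_mor_zero₂₃ _ hT₄
    rw [← Category.assoc, this, zero_comp]
  have hsr : s ≫ r = 𝟙 V := by
    rw [← sub_eq_zero]
    refine NoHom.eq_zero_of_comp_mor₁ hT₄ hVW ?_
    rw [Preadditive.sub_comp, Category.assoc, ← hr, hsv, Category.id_comp, sub_self]
  exact IsExtension.of_iso ⟨_, _, _, hT₄⟩ ⟨s, r, hsr, hrs⟩ (Iso.refl _) (Iso.refl _)

/-- A form of the octahedral axiom which, thanks to the vanishing of some morphisms,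
holds in any pretriangulated category: an extension by an extension is an iterated
extension. -/
lemma IsExtension.assoc_symm_of_noHom {X Z P B Q : C} (h₁ : IsExtension X Z B)
    (h₂ : IsExtension P B Q) (hXP : NoHom X P)
    (hXP' : NoHom (X⟦(1 : ℤ)⟧) P) (hXQ' : NoHom (X⟦(1 : ℤ)⟧) Q)
    (hPP : NoHom (P⟦(1 : ℤ)⟧) P) (hPQ : NoHom (P⟦(1 : ℤ)⟧) Q)
    (hQP : NoHom (Q⟦(1 : ℤ)⟧) P) (hQQ : NoHom (Q⟦(1 : ℤ)⟧) Q) :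
    ∃ Y, IsExtension X Y P ∧ IsExtension Y Z Q := by
  have h₁' := h₁
  have h₂' := h₂
  obtain ⟨f, p, x, hT₁⟩ := h₁
  obtain ⟨i, q, w, hT₂⟩ := h₂
  obtain ⟨Y, y, z, hT₃⟩ := distinguished_cocone_triangle₁ (p ≫ q)
  refine ⟨Y, ?_, ⟨_, _, _, hT₃⟩⟩
  obtain ⟨τ, hτ₁, hτ₂⟩ : ∃ τ : Y ⟶ P, y ≫ p = τ ≫ i ∧ z ≫ τ⟦(1 : ℤ)⟧' = w := by
    obtain ⟨τ, hτ₁, hτ₂⟩ := complete_distinguished_triangle_morphism₁ _ _ hT₃ hT₂ p (𝟙 Q)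
      (Category.comp_id _)
    exact ⟨τ, hτ₁, hτ₂.trans (Category.id_comp w)⟩
  have hfp : f ≫ p = 0 := comp_distTriang_mor_zero₁₂ _ hT₁
  have hiq : i ≫ q = 0 := comp_distTriang_mor_zero₁₂ _ hT₂
  obtain ⟨V, v, o, hT₄⟩ := distinguished_cocone_triangle₁ τ
  have hvτ : v ≫ τ = 0 := comp_distTriang_mor_zero₁₂ _ hT₄
  have hτo : τ ≫ o = 0 := comp_distTriang_mor_zero₂₃ _ hT₄
  have hV : ∀ N, NoHom (X⟦(1 : ℤ)⟧) N → NoHom (P⟦(1 : ℤ)⟧) N → NoHom (Q⟦(1 : ℤ)⟧) N →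
      NoHom (V⟦(1 : ℤ)⟧) N := by
    intro N hX hP hQ
    have hZ : NoHom (Z⟦(1 : ℤ)⟧) N :=
      (h₁'.shift 1).noHom_left hX ((h₂'.shift 1).noHom_left hP hQ)
    have hY : NoHom (Y⟦(1 : ℤ)⟧) N := by
      intro e
      refine NoHom.eq_zero_of_mor₃_comp hT₃ hZ (NoHom.eq_zero_of_mor₂_comp hT₂ hP
        (NoHom.eq_zero_of_mor₂_comp hT₁ hX ?_))
      have : (p ≫ q) ≫ z = 0 := comp_distTriang_mor_zero₂₃ _ hT₃
      rw [← Category.assoc, ← Category.assoc, this, zero_comp]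
    intro e
    refine NoHom.eq_zero_of_mor₃_comp hT₄ hY ?_
    have hoe : τ ≫ o ≫ e = 0 := by rw [← Category.assoc, hτo, zero_comp]
    generalize o ≫ e = e₀ at hoe
    obtain ⟨e', rfl⟩ : ∃ e' : B ⟶ N, e₀ = i ≫ e' := by
      refine exists_desc_mor₁ hT₂ e₀ ?_
      rw [← hτ₂, Category.assoc, ← Functor.map_comp, hoe, Functor.map_zero, comp_zero]
    obtain ⟨e'', he''⟩ := exists_desc_mor₂ hT₃ (p ≫ e') (by
      rw [← Category.assoc, hτ₁, Category.assoc, hoe])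
    have : e' - q ≫ e'' = 0 := NoHom.eq_zero_of_mor₂_comp hT₁ hX
      (by rw [Preadditive.comp_sub, he'', Category.assoc, sub_self])
    rw [sub_eq_zero.1 this, ← Category.assoc, hiq, zero_comp]
  obtain ⟨ρ, hρ⟩ := exists_lift_mor₁ hT₃ f (by
    rw [← Category.assoc, hfp, zero_comp])
  obtain ⟨r, hr⟩ := exists_lift_mor₁ hT₄ ρ (hXP _)
  obtain ⟨s, hs⟩ := exists_lift_mor₁ hT₁ (v ≫ y) (by
    rw [Category.assoc, hτ₁, ← Category.assoc, hvτ, zero_comp])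
  have hrs : r ≫ s = 𝟙 X := by
    rw [← sub_eq_zero]
    refine NoHom.eq_zero_of_comp_mor₁ hT₁ (h₂'.noHom_right hXP' hXQ') ?_
    rw [Preadditive.sub_comp, Category.assoc, ← hs, ← Category.assoc, ← hr, ← hρ,
      Category.id_comp, sub_self]
  have hsr : s ≫ r = 𝟙 V := by
    rw [← sub_eq_zero]
    refine NoHom.eq_zero_of_comp_mor₁ hT₄ (hV P hXP' hPP hQP)
      (NoHom.eq_zero_of_comp_mor₁ hT₃ (hV Q hXQ' hPQ hQQ) ?_)
    rw [Preadditive.sub_comp, Category.assoc, ← hr, Preadditive.sub_comp, Category.assoc,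
      ← hρ, ← hs, Category.id_comp, sub_self]
  exact IsExtension.of_iso ⟨_, _, _, hT₄⟩ ⟨s, r, hsr, hrs⟩ (Iso.refl _) (Iso.refl _)

/-- Morphisms of negative degree between objects of `S` vanish. -/
def NoNegHom (S : Set C) : Prop := ∀ E ∈ S, ∀ F ∈ S, ∀ n : ℤ, n < 0 → NoHom E (F⟦n⟧)

lemma NoNegHom.shift {S : Set C} (hS : NoNegHom S) {E F : C} (hE : E ∈ S) (hF : F ∈ S)
    {a b : ℤ} (hab : b < a) : NoHom (E⟦a⟧) (F⟦b⟧) :=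
  (hS E hE F hF (b - a) (by omega)).shift' a b (by omega)

lemma NoNegHom.shift_shift {S : Set C} (hS : NoNegHom S) {E F : C} (hE : E ∈ S) (hF : F ∈ S)
    (a : ℤ) : NoHom (E⟦a⟧⟦(1 : ℤ)⟧) (F⟦a⟧) :=
  (hS.shift hE hF (b := a - 1) (by omega)).shift' 1 a (by omega)

/-- `Filtered S n X` means that `X` is a finite iterated extension of shifts by strictly
decreasing integers `≥ n` of objects of `S`. -/
inductive Filtered (S : Set C) : ℤ → C → Prop
  | zero (n : ℤ) (X : C) (h : IsZero X) : Filtered S n X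
  | step (n k : ℤ) (X Y B : C) (hnk : n ≤ k) (hB : B ∈ S) (h : IsExtension X Y (B⟦k⟧))
      (hX : Filtered S (k + 1) X) : Filtered S n Y

namespace Filtered

variable {S : Set C}

lemma mono {n m : ℤ} {X : C} (h : Filtered S n X) (hm : m ≤ n) : Filtered S m X := by
  cases h with
  | zero _ _ h => exact zero _ _ h
  | step _ k X' _ B hnk hB h hX => exact step _ k X' _ B (hm.trans hnk) hB h hX

lemma of_iso {n : ℤ} {X Y : C} (h : Filtered S n X) (e : X ≅ Y) : Filtered S n Y := by
  cases h with
  | zero _ _ h => exact zero _ _ (h.of_iso e.symm)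
  | step _ k X' _ B hnk hB h hX =>
    exact step _ k X' _ B hnk hB (h.of_iso (Iso.refl _) e (Iso.refl _)) hX

lemma noHom (hS : NoNegHom S) {n : ℤ} {X : C} (h : Filtered S n X) {B : C} (hB : B ∈ S)
    {j : ℤ} (hj : j < n) : NoHom X (B⟦j⟧) := by
  induction h with
  | zero n X h => exact fun f => h.eq_of_src _ _
  | step n k X Y A hnk hA h hX ih => exact h.noHom_left (ih (by omega)) (hS.shift hA hB (by omega))

lemma noHom_shift (hS : NoNegHom S) {n : ℤ} {X : C} (h : Filtered S n X) {B : C} (hB : B ∈ S)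
    {j : ℤ} (hj : j ≤ n) : NoHom (X⟦(1 : ℤ)⟧) (B⟦j⟧) :=
  (h.noHom hS hB (j := j - 1) (by omega)).shift' 1 j (by omega)

/-- The objects with a filtration by shifts `≥ n` are stable under extensions by `S⟦n⟧`, if
`S` is stable under extensions. -/
lemma extend (hS : NoNegHom S) (hext : ∀ X Y Z, IsExtension X Y Z → X ∈ S → Z ∈ S → Y ∈ S)
    {n : ℤ} {X Y B : C} (hX : Filtered S n X) (hB : B ∈ S) (h : IsExtension X Y (B⟦n⟧)) :
    Filtered S n Y := by
  cases hX with
  | zero _ _ h₀ => exact step n n X Y B le_rfl hB h (zero _ _ h₀)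
  | step _ k X' _ A hnk hA h' hX₀ =>
    obtain rfl | hlt := hnk.eq_or_lt
    · obtain ⟨W, hW, hXYW⟩ := h'.assoc_of_noHom h (hX₀.noHom hS hA (by omega))
        (hX₀.noHom hS hB (by omega)) (hX₀.noHom_shift hS hA (by omega))
        (hX₀.noHom_shift hS hB (by omega)) (hS.shift_shift hA hA n) (hS.shift_shift hA hB n)
        (hS.shift_shift hB hA n) (hS.shift_shift hB hB n)
      have hW' : IsExtension A (W⟦-n⟧) B := (hW.shift (-n)).of_iso
        ((shiftEquiv C n).unitIso.app A).symm (Iso.refl _) ((shiftEquiv C n).unitIso.app B).symm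
      exact step n n X' Y (W⟦-n⟧) le_rfl (hext _ _ _ hW' hA hB)
        (hXYW.of_iso (Iso.refl _) (Iso.refl _) ((shiftEquiv C n).counitIso.app W).symm) hX₀
    · exact step n n X Y B le_rfl hB h (step _ k X' X A (by omega) hA h' hX₀)

/-- The filtration in the definition of a heart gives a filtration in the inductive sense. -/
lemma of_sequence {m : ℕ} {X : Fin (m + 1) → C} {k : Fin m → ℤ} {A : Fin m → C}
    (h₀ : IsZero (X 0)) (hk : StrictAnti k) (hA : ∀ i, A i ∈ S)
    (h : ∀ i : Fin m, IsExtension (X i.castSucc) (X i.succ) ((A i)⟦k i⟧))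
    (i : Fin (m + 1)) : ∀ n : ℤ, (∀ j : Fin m, j.castSucc < i → n ≤ k j) →
      Filtered S n (X i) := by
  induction i using Fin.induction with
  | zero => exact fun n _ => zero _ _ h₀
  | succ i ih =>
    intro n hn
    refine step n (k i) _ _ _ (hn i Fin.castSucc_lt_succ) (hA i) (h i) (ih _ fun j hj => ?_)
    have := hk (Fin.castSucc_lt_castSucc_iff.1 hj)
    omega

lemma exists_sequence {n : ℤ} {G : C} (hG : Filtered S n G) :
    ∃ (m : ℕ) (X : Fin (m + 1) → C) (k : Fin m → ℤ) (A : Fin m → C),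
      IsZero (X 0) ∧ X (Fin.last m) = G ∧ StrictAnti k ∧ (∀ i, n ≤ k i) ∧ (∀ i, A i ∈ S) ∧
      ∀ i : Fin m, IsExtension (X i.castSucc) (X i.succ) ((A i)⟦k i⟧) := by
  induction hG with
  | zero n X h =>
    exact ⟨0, fun _ => X, Fin.elim0, Fin.elim0, h, rfl, fun i => i.elim0, fun i => i.elim0,
      fun i => i.elim0, fun i => i.elim0⟩
  | step n k X Y B hnk hB h hX ih =>
    obtain ⟨m, X', k', A, h₀, hl, hk', hn, hA, hX'⟩ := ih
    refine ⟨m + 1, Fin.snoc X' Y, Fin.snoc k' k, Fin.snoc A B, ?_, ?_, ?_, ?_, ?_, ?_⟩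
    · have : (Fin.snoc X' Y : Fin (m + 1 + 1) → C) 0 = X' 0 :=
        Fin.snoc_castSucc (α := fun _ => C) Y X' 0
      rwa [this]
    · exact Fin.snoc_last (α := fun _ => C) Y X'
    · intro i j hij
      induction j using Fin.lastCases with
      | last =>
        induction i using Fin.lastCases with
        | last => exact absurd hij (lt_irrefl _)
        | cast i =>
          have := hn i
          simp only [Fin.snoc_last, Fin.snoc_castSucc]
          omega
      | cast j =>
        induction i using Fin.lastCases with
        | last => exact absurd hij (not_lt.2 (Fin.le_last _))
        | cast i =>
          simp only [Fin.snoc_castSucc]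
          exact hk' (Fin.castSucc_lt_castSucc_iff.1 hij)
    · intro i
      induction i using Fin.lastCases with
      | last => simpa only [Fin.snoc_last] using hnk
      | cast i =>
        have := hn i
        simp only [Fin.snoc_castSucc]
        omega
    · intro i
      induction i using Fin.lastCases with
      | last => simpa only [Fin.snoc_last] using hB
      | cast i => simpa only [Fin.snoc_castSucc] using hA i
    · intro i
      induction i using Fin.lastCases with
      | last => simpa only [Fin.succ_last, Fin.snoc_last, Fin.snoc_castSucc, hl] using h
      | cast i => simpa only [Fin.succ_castSucc, Fin.snoc_castSucc] using hX' i

end Filtered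

lemma IsHeart.noNegHom {S : Set C} (hS : IsHeart S) : NoNegHom S := hS.1

lemma IsHeart.exists_filtered {S : Set C} (hS : IsHeart S) (G : C) :
    ∃ n, Filtered S n G := by
  obtain ⟨m, X, f, k, A, h₀, ⟨e⟩, hk, hA, h⟩ := hS.2 G
  obtain ⟨n, hn⟩ := (Set.finite_range k).bddBelow
  exact ⟨n, (Filtered.of_sequence h₀ hk hA (fun i => ⟨f i, h i⟩) (Fin.last m) n
    fun j _ => hn ⟨j, rfl⟩).of_iso e⟩

lemma isHeart_of_filtered {S : Set C} (hS : NoNegHom S) (h : ∀ G : C, ∃ n, Filtered S n G) :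
    IsHeart S := by
  refine ⟨hS, fun G => ?_⟩
  obtain ⟨n, hn⟩ := h G
  obtain ⟨m, X, k, A, h₀, hl, hk, -, hA, hX⟩ := hn.exists_sequence
  choose f g w hT using hX
  exact ⟨m, X, f, k, A, h₀, ⟨eqToIso hl⟩, hk, hA, fun i => ⟨g i, w i, hT i⟩⟩

lemma ExtClosed.noHom {S S' : Set C} {n : ℤ} (h : ∀ E ∈ S, ∀ F ∈ S', NoHom E (F⟦n⟧)) {E F : C}
    (hE : ExtClosed S E) (hF : ExtClosed S' F) : NoHom E (F⟦n⟧) := by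
  induction hE with
  | zero X hX => exact fun f => hX.eq_of_src _ _
  | ext X E Z g h w hT hX hZ ihX ihZ => exact IsExtension.noHom_left ⟨_, _, _, hT⟩ ihX ihZ
  | of X hX =>
    induction hF with
    | of Y hY => exact h X hX Y hY
    | zero Y hY => exact fun f => ((shiftFunctor C n).map_isZero hY).eq_of_tgt _ _
    | ext Y F Z g h w hT hY hZ ihY ihZ =>
      exact (IsExtension.shift ⟨_, _, _, hT⟩ n).noHom_right ihY ihZ

lemma ExtClosed.of_isExtension {S : Set C} {X Y Z : C} (h : IsExtension X Y Z)
    (hX : ExtClosed S X) (hZ : ExtClosed S Z) : ExtClosed S Y := by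
  obtain ⟨f, g, w, hT⟩ := h
  exact .ext X Y Z f g w hT hX hZ

/-- If every object of `A` is an extension of an object of `F` by an object of `T`, and `S`
contains `T` and `F⟦1⟧`, then an object filtered by `A` is filtered by `S`. -/
lemma Filtered.tilt {A T F S : Set C} (hA : NoNegHom A) (hTA : T ⊆ A) (hFA : F ⊆ A)
    (hdec : ∀ E ∈ A, ∃ X ∈ T, ∃ Y ∈ F, IsExtension X E Y)
    (hS : NoNegHom S) (hext : ∀ X Y Z, IsExtension X Y Z → X ∈ S → Z ∈ S → Y ∈ S)
    (hTS : T ⊆ S) (hFS : ∀ Y ∈ F, Y⟦(1 : ℤ)⟧ ∈ S) {n : ℤ} {G : C} (hG : Filtered A n G) :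
    Filtered S (n - 1) G := by
  induction hG with
  | zero n X h => exact .zero _ _ h
  | step n k X Z B hnk hB h hX ih =>
    obtain ⟨P, hP, Q, hQ, hPQ⟩ := hdec B hB
    obtain ⟨Y, hXY, hYZ⟩ := h.assoc_symm_of_noHom (hPQ.shift k)
      (hX.noHom hA (hTA hP) (by omega)) (hX.noHom_shift hA (hTA hP) (by omega))
      (hX.noHom_shift hA (hFA hQ) (by omega)) (hA.shift_shift (hTA hP) (hTA hP) k)
      (hA.shift_shift (hTA hP) (hFA hQ) k) (hA.shift_shift (hFA hQ) (hTA hP) k)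
      (hA.shift_shift (hFA hQ) (hFA hQ) k)
    have hY : Filtered S k Y := (ih.mono (by omega)).extend hS hext (hTS hP) hXY
    exact .step (n - 1) (k - 1) Y Z (Q⟦(1 : ℤ)⟧) (by omega) (hFS Q hQ)
      (hYZ.of_iso (Iso.refl _) (Iso.refl _)
        ((shiftFunctorAdd' C 1 (k - 1) k (by omega)).app Q)) (hY.mono (by omega))

/-- Happel–Reiten–Smalø tilting: given a torsion pair `(T, F)` on the heart `A`
of a bounded t-structure on `D`, the extension closure `⟨T, F[1]⟩` is again the
heart of a bounded t-structure on `D`. (Short exact sequences in the heart are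
encoded by distinguished triangles.) -/
theorem stmt13 (A : Set C) (hA : IsHeart A) (T F : Set C)
    (hTA : T ⊆ A) (hFA : F ⊆ A)
    (htor : ∀ X ∈ T, ∀ Y ∈ F, ∀ f : X ⟶ Y, f = 0)
    (hdec : ∀ E ∈ A, ∃ X ∈ T, ∃ Y ∈ F,
      ∃ (g : X ⟶ E) (h : E ⟶ Y) (w : Y ⟶ X⟦(1 : ℤ)⟧),
        Triangle.mk g h w ∈ distTriang C) :
    IsHeart {E : C |
      ExtClosed (T ∪ {Z : C | ∃ Y ∈ F, Nonempty (Z ≅ Y⟦(1 : ℤ)⟧)}) E} := by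
  have hAn := hA.noNegHom
  have hS : NoNegHom {E : C |
      ExtClosed (T ∪ {Z : C | ∃ Y ∈ F, Nonempty (Z ≅ Y⟦(1 : ℤ)⟧)}) E} := by
    intro E hE G hG n hn
    refine ExtClosed.noHom ?_ hE hG
    rintro X (hX | ⟨X', hX', ⟨eX⟩⟩) Y (hY | ⟨Y', hY', ⟨eY⟩⟩)
    · exact hAn X (hTA hX) Y (hTA hY) n hn
    · have h : NoHom X (Y'⟦n + 1⟧) := by
        obtain hn' | hn' := (show n + 1 ≤ 0 by omega).lt_or_eq
        · exact hAn X (hTA hX) Y' (hFA hY') _ hn'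
        · rw [hn']
          exact NoHom.of_iso (htor X hX Y' hY') (Iso.refl _) ((shiftFunctorZero C ℤ).app Y').symm
      exact h.of_iso (Iso.refl _) ((shiftFunctorAdd' C 1 n (n + 1) (by omega)).app Y' ≪≫
        (shiftFunctor C n).mapIso eY.symm)
    · exact (hAn.shift (hFA hX') (hTA hY) (by omega)).of_iso eX.symm (Iso.refl _)
    · exact (hAn.shift (hFA hX') (hFA hY') (a := 1) (b := n + 1) (by omega)).of_iso eX.symm
        ((shiftFunctorAdd' C 1 n (n + 1) (by omega)).app Y' ≪≫
          (shiftFunctor C n).mapIso eY.symm)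
  refine isHeart_of_filtered hS fun G => ?_
  obtain ⟨n, hn⟩ := hA.exists_filtered G
  exact ⟨n - 1, hn.tilt hAn hTA hFA hdec hS
    (fun X Y Z h hX hZ => ExtClosed.of_isExtension h hX hZ)
    (fun X hX => .of X (Or.inl hX)) (fun Y hY => .of _ (Or.inr ⟨Y, hY, ⟨Iso.refl _⟩⟩))⟩
end

section
/- Let A be an abelian category with a weak stability function Z : K(A) → ℂ (meaning Im Z(E) ≥ 0 for all E ∈ A, and Im Z(E) = 0 implies Re Z(E) ≤ 0) such that Harder–Narasimhan filtrations exist for Z on A. Let A₁ ⊂ A be a full abelian subcategory such that the inclusion A₁ → A is exact, and assume Z restricted to K(A₁) is a stability function (i.e. additionally Im Z(E) = 0 implies Re Z(E) < 0 for nonzero E ∈ A₁). If every object of A₁ has Harder–Narasimhan polygon (with respect to subobjects in A₁) which is finite polyhedral on the left, then Harder–Narasimhan filtrations with respect to Z exist for all objects of A₁. -/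
open CategoryTheory Limits

universe v u

variable {C : Type u} [Category.{v} C] [Abelian C]

/-- `μ(z) ≤ μ(w)` for the slope `μ = -Re/Im` (with `μ = +∞` when `Im = 0`),
encoded without division. -/
def slopeLE (z w : ℂ) : Prop := w.re * z.im ≤ z.re * w.im

/-- `μ(z) < μ(w)`. -/
def slopeLT (z w : ℂ) : Prop := w.re * z.im < z.re * w.im

/-- `F` is `Z`-semistable within the full (abelian, exactly embedded)
subcategory whose objects are `P`: every nonzero subobject lying in `P` has
slope at most `μ(F)`. -/
def SemistableIn (Z : C → ℂ) (P : Set C) (F : C) : Prop :=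
  F ∈ P ∧ ¬ IsZero F ∧
    ∀ (A : C) (ι : A ⟶ F), Mono ι → A ∈ P → ¬ IsZero A →
      slopeLE (Z A) (Z F)

/-- `E` admits a Harder–Narasimhan filtration within `P`: a finite chain of
monomorphisms `0 = X₀ ↪ X₁ ↪ ⋯ ↪ Xₙ ≅ E` with all `Xᵢ ∈ P`, whose successive
quotients are `Z`-semistable in `P` with strictly decreasing slopes. -/
def HasHNFiltrationIn (Z : C → ℂ) (P : Set C) (E : C) : Prop :=
  ∃ (n : ℕ) (X : Fin (n + 1) → C)
    (f : ∀ i : Fin n, X i.castSucc ⟶ X i.succ),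
    IsZero (X 0) ∧ Nonempty (X (Fin.last n) ≅ E) ∧
    (∀ i, X i ∈ P) ∧ (∀ i, Mono (f i)) ∧
    (∀ i, SemistableIn Z P (cokernel (f i))) ∧
    (∀ i j : Fin n, i < j →
      slopeLT (Z (cokernel (f j))) (Z (cokernel (f i))))

/-- The lexicographic order on `ℂ` by `-Re - t * Im` and then by `Im`. -/
def lexLE (t : ℝ) (z w : ℂ) : Prop :=
  -z.re - t * z.im < -w.re - t * w.im ∨ (-z.re - t * z.im = -w.re - t * w.im ∧ z.im ≤ w.im)

theorem lexLE.antisymm {t : ℝ} {z w : ℂ} (h : lexLE t z w) (h' : lexLE t w z) : z = w := by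
  unfold lexLE at *
  have him : z.im = w.im := by grind
  apply Complex.ext _ him
  rw [him] at h h'
  grind

theorem lexLE.le {t : ℝ} {z w : ℂ} (h : lexLE t z w) :
    -z.re - t * z.im ≤ -w.re - t * w.im := by
  unfold lexLE at h; grind

theorem convex_lexLE (t : ℝ) (w : ℂ) : Convex ℝ {z | lexLE t z w} := by
  intro x hx y hy a b ha hb hab
  simp only [Set.mem_ofPred_eq, lexLE, Complex.add_re, Complex.add_im, Complex.real_smul,
    Complex.mul_re, Complex.mul_im, Complex.ofReal_re, Complex.ofReal_im, zero_mul, sub_zero,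
    add_zero] at *
  obtain rfl : b = 1 - a := by linarith
  rcases ha.eq_or_lt with rfl | ha
  · simpa using hy
  rcases hb.eq_or_lt with hb | hb
  · obtain rfl : a = 1 := by linarith
    simpa using hx
  rcases hx with hx | ⟨hx, hx'⟩ <;> rcases hy with hy | ⟨hy, hy'⟩
  · left; nlinarith
  · left; nlinarith
  · left; nlinarith
  · right; constructor
    · linear_combination a * hx + (1 - a) * hy
    · nlinarith

theorem convex_not_lexLE (t : ℝ) (w : ℂ) : Convex ℝ {z | ¬ lexLE t w z} := by
  intro x hx y hy a b ha hb hab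
  simp only [Set.mem_ofPred_eq, lexLE, Complex.add_re, Complex.add_im, Complex.real_smul,
    Complex.mul_re, Complex.mul_im, Complex.ofReal_re, Complex.ofReal_im, zero_mul, sub_zero,
    add_zero, not_or, not_and, not_lt, not_le] at *
  obtain rfl : b = 1 - a := by linarith
  rcases ha.eq_or_lt with rfl | ha
  · simpa using hy
  rcases hb.eq_or_lt with hb | hb
  · obtain rfl : a = 1 := by linarith
    simpa using hx
  refine ⟨by nlinarith, fun h => ?_⟩
  have h1 : -w.re - t * w.im = -x.re - t * x.im := by nlinarith
  have h2 : -w.re - t * w.im = -y.re - t * y.im := by nlinarith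
  nlinarith [hx.2 h1, hy.2 h2]

/-- A lexicographic order attains its maximum on any finite nonempty set. -/
theorem exists_lexLE_max (t : ℝ) {s : Finset ℂ} (hs : s.Nonempty) :
    ∃ w ∈ s, ∀ z ∈ s, lexLE t z w := by
  obtain ⟨w, hw, h⟩ := s.exists_max_image
    (fun z => toLex (-z.re - t * z.im, z.im)) hs
  exact ⟨w, hw, fun z hz => by simpa [Prod.Lex.toLex_le_toLex, lexLE] using h z hz⟩

section Lattice

variable {L : Type*} [PartialOrder L] {Z : L → ℂ}

/-- A lexicographic maximum of a strictly monotone modular function is unique. -/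
theorem eq_of_lexLE_max
    (hmod : ∀ A B, ∃ I J, I ≤ A ∧ I ≤ B ∧ A ≤ J ∧ B ≤ J ∧ Z I + Z J = Z A + Z B)
    (hlt : ∀ A B, A < B →
      (Z A).im < (Z B).im ∨ ((Z A).im = (Z B).im ∧ (Z B).re < (Z A).re))
    {t : ℝ} {A B : L} (hA : ∀ B, lexLE t (Z B) (Z A)) (hB : lexLE t (Z A) (Z B)) : A = B := by
  have hinj : ∀ X Y, X ≤ Y → Z X = Z Y → X = Y := fun X Y h h' => by
    by_contra hne
    have := hlt X Y (lt_of_le_of_ne h hne)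
    simp [h'] at this
  have hAB : Z A = Z B := hB.antisymm (hA B)
  obtain ⟨I, J, -, -, hAJ, hBJ, hIJ⟩ := hmod A B
  have hJ : Z J = Z A := by
    refine (hA J).antisymm ?_
    have hI := hA I
    rw [← hAB] at hIJ
    have hre := congrArg Complex.re hIJ
    have him := congrArg Complex.im hIJ
    simp only [Complex.add_re, Complex.add_im] at hre him
    unfold lexLE at hI ⊢
    have e : (-(Z I).re - t * (Z I).im) + (-(Z J).re - t * (Z J).im)
        = 2 * (-(Z A).re - t * (Z A).im) := by linear_combination -hre - t * him
    grind
  rw [hinj A J hAJ hJ.symm, hinj B J hBJ (hAB ▸ hJ.symm)]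

/-- Lexicographic maxima decrease as the slope increases. -/
theorem antitone_of_lexLE_max
    (hmod : ∀ A B, ∃ I J, I ≤ A ∧ I ≤ B ∧ A ≤ J ∧ B ≤ J ∧ Z I + Z J = Z A + Z B)
    (hlt : ∀ A B, A < B →
      (Z A).im < (Z B).im ∨ ((Z A).im = (Z B).im ∧ (Z B).re < (Z A).re))
    {a : ℝ → L} (ha : ∀ t B, lexLE t (Z B) (Z (a t))) : Antitone a := by
  intro t t' htt
  obtain ⟨I, J, -, -, hAJ, hBJ, hIJ⟩ := hmod (a t') (a t)
  suffices a t = J by rwa [this]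
  refine eq_of_lexLE_max hmod hlt (ha t) ?_
  have hI := (ha t' I).le
  have hre := congrArg Complex.re hIJ
  have him := congrArg Complex.im hIJ
  simp only [Complex.add_re, Complex.add_im] at hre him
  have hy : (Z (a t)).im ≤ (Z J).im := by
    rcases hBJ.eq_or_lt with h | h
    · rw [h]
    · rcases hlt _ _ h with h | h
      · exact h.le
      · exact h.1.le
  have e : (-(Z I).re - t' * (Z I).im) + (-(Z J).re - t' * (Z J).im)
      = (-(Z (a t')).re - t' * (Z (a t')).im) + (-(Z (a t)).re - t' * (Z (a t)).im) := by
    linear_combination -hre - t' * him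
  have key : -(Z (a t)).re - t * (Z (a t)).im ≤ -(Z J).re - t * (Z J).im := by
    nlinarith [mul_le_mul_of_nonneg_left hy (sub_nonneg.2 htt)]
  rcases key.lt_or_eq with h | h
  · exact Or.inl h
  · exact Or.inr ⟨h, hy⟩

/-- A finite chain with a least element can be enumerated increasingly. -/
theorem exists_enumeration_of_chain [OrderBot L] {R : Set L} (hR : R.Finite) (hbot : ⊥ ∈ R)
    (htot : ∀ A ∈ R, ∀ B ∈ R, A ≤ B ∨ B ≤ A) :
    ∃ (n : ℕ) (c : Fin (n + 1) → L), StrictMono c ∧ Set.range c = R := by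
  classical
  let : Fintype R := hR.fintype
  let : LinearOrder R :=
    { (inferInstance : PartialOrder R) with
      le_total := fun A B => htot A A.2 B B.2
      toDecidableLE := Classical.decRel _ }
  obtain ⟨n, hn⟩ : ∃ n, Fintype.card R = n + 1 :=
    have : Nonempty R := ⟨⟨⊥, hbot⟩⟩
    Nat.exists_eq_succ_of_ne_zero Fintype.card_ne_zero
  let e := monoEquivOfFin R hn
  refine ⟨n, fun i => e i, fun i j h => e.strictMono h, ?_⟩
  ext A
  constructor
  · rintro ⟨i, rfl⟩
    exact (e i).2
  · intro hA
    exact ⟨e.symm ⟨A, hA⟩, by simp⟩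

variable [BoundedOrder L]

/-- If the polygon of `Z` is finite polyhedral on the left, every lexicographic order attains its
maximum on the values of `Z`, at a point of a fixed finite set. -/
theorem exists_lexLE_max_of_polyhedral (h0 : Z ⊥ = 0)
    (him : ∀ A, 0 ≤ (Z A).im) (him' : ∀ A, (Z A).im ≤ (Z ⊤).im) {s : Finset ℂ}
    (hs : convexHull ℝ (Set.range Z) ∩ {z : ℂ | 0 ≤ (Z ⊤).re * z.im - (Z ⊤).im * z.re}
      = convexHull ℝ (s : Set ℂ)) (t : ℝ) :
    ∃ A, Z A ∈ s ∧ ∀ B, lexLE t (Z B) (Z A) := by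
  have hmem : ∀ A, 0 ≤ (Z ⊤).re * (Z A).im - (Z ⊤).im * (Z A).re →
      Z A ∈ convexHull ℝ (s : Set ℂ) := fun A hA =>
    hs ▸ ⟨subset_convexHull ℝ _ ⟨A, rfl⟩, hA⟩
  have hbot := hmem ⊥ (by simp [h0])
  have htop := hmem ⊤ (by simp [mul_comm])
  obtain ⟨w, hw, hmax⟩ := exists_lexLE_max t
    (s := s) (by simpa using convexHull_nonempty_iff.1 ⟨_, hbot⟩)
  have hmax' : ∀ z ∈ convexHull ℝ (s : Set ℂ), lexLE t z w := fun z hz =>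
    convexHull_min (fun z hz => hmax z hz) (convex_lexLE t w) hz
  have hall : ∀ B, lexLE t (Z B) w := by
    intro B
    by_cases hB : 0 ≤ (Z ⊤).re * (Z B).im - (Z ⊤).im * (Z B).re
    · exact hmax' _ (hmem B hB)
    · left
      have e0 := (hmax' _ hbot).le
      have e1 := (hmax' _ htop).le
      rw [h0] at e0
      simp only [Complex.zero_re, Complex.zero_im] at e0
      have hb := him B
      have hb' := him' B
      have hpos : 0 < (Z ⊤).im := by
        by_contra hcon
        have h1 : (Z ⊤).im = 0 := le_antisymm (not_lt.1 hcon) (him _)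
        have h2 : (Z B).im = 0 := by linarith
        simp [h1, h2] at hB
      by_contra hcon
      nlinarith [mul_le_mul_of_nonneg_left e1 hb,
        mul_le_mul_of_nonneg_left e0 (sub_nonneg.2 hb'),
        mul_le_mul_of_nonneg_left (not_lt.1 hcon) hpos.le]
  have hwS : w ∈ convexHull ℝ (Set.range Z) := by
    have : w ∈ convexHull ℝ (s : Set ℂ) := subset_convexHull ℝ _ hw
    rw [← hs] at this
    exact this.1
  obtain ⟨A, hA⟩ : ∃ A, lexLE t w (Z A) := by
    by_contra! hcon
    have : w ∈ {z | ¬ lexLE t w z} :=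
      convexHull_min (by rintro _ ⟨A, rfl⟩; exact hcon A) (convex_not_lexLE t w) hwS
    exact this (Or.inr ⟨rfl, le_rfl⟩)
  have hAw := (hall A).antisymm hA
  exact ⟨A, hAw ▸ hw, fun B => hAw ▸ hall B⟩


/-- The order-theoretic core of the existence of Harder–Narasimhan filtrations. -/
theorem exists_hn_chain (h0 : Z ⊥ = 0)
    (hmod : ∀ A B, ∃ I J, I ≤ A ∧ I ≤ B ∧ A ≤ J ∧ B ≤ J ∧ Z I + Z J = Z A + Z B)
    (hlt : ∀ A B, A < B →
      (Z A).im < (Z B).im ∨ ((Z A).im = (Z B).im ∧ (Z B).re < (Z A).re))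
    {s : Finset ℂ}
    (hs : convexHull ℝ (Set.range Z) ∩ {z : ℂ | 0 ≤ (Z ⊤).re * z.im - (Z ⊤).im * z.re}
      = convexHull ℝ (s : Set ℂ)) :
    ∃ (n : ℕ) (c : Fin (n + 1) → L), StrictMono c ∧ c 0 = ⊥ ∧ c (Fin.last n) = ⊤ ∧
      (∀ (i : Fin n) (B : L), c i.castSucc ≤ B → B ≤ c i.succ →
        slopeLE (Z B - Z (c i.castSucc)) (Z (c i.succ) - Z (c i.castSucc))) ∧
      ∀ i j : Fin n, i < j → slopeLT (Z (c j.succ) - Z (c j.castSucc))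
        (Z (c i.succ) - Z (c i.castSucc)) := by
  have himle : ∀ A B, A ≤ B → (Z A).im ≤ (Z B).im := by
    intro A B h
    rcases h.eq_or_lt with h | h
    · rw [h]
    · rcases hlt _ _ h with h | h
      · exact h.le
      · exact h.1.le
  have him : ∀ A, 0 ≤ (Z A).im := fun A => by simpa [h0] using himle ⊥ A bot_le
  choose a has ha using
    exists_lexLE_max_of_polyhedral h0 him (fun A => himle A ⊤ le_top) hs
  have hanti : Antitone a := antitone_of_lexLE_max hmod hlt ha
  have hfin : (Set.range a).Finite := by
    refine Set.Finite.of_injOn (f := Z) (t := (s : Set ℂ)) ?_ ?_ s.finite_toSet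
    · rintro _ ⟨t, rfl⟩
      exact has t
    · rintro _ ⟨t, rfl⟩ _ ⟨t', rfl⟩ h
      exact eq_of_lexLE_max hmod hlt (ha t) (Or.inr (by simp [h]))
  obtain ⟨n, c, hc, hcR⟩ := exists_enumeration_of_chain (hfin.insert ⊥)
    (Set.mem_insert _ _) (by
      rintro A (rfl | ⟨t, rfl⟩) B (rfl | ⟨t', rfl⟩)
      · simp
      · simp
      · simp
      · exact (le_total t' t).imp (fun h => hanti h) (fun h => hanti h))
  have hcmem : ∀ i, c i = ⊥ ∨ ∃ t, a t = c i := fun i => by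
    have : c i ∈ insert ⊥ (Set.range a) := hcR ▸ ⟨i, rfl⟩
    exact this
  have hamem : ∀ t, ∃ i, c i = a t := fun t => by
    have : a t ∈ Set.range c := hcR ▸ Or.inr ⟨t, rfl⟩
    exact this
  have hc0 : c 0 = ⊥ := by
    obtain ⟨i, hi⟩ : ⊥ ∈ Set.range c := hcR ▸ Or.inl rfl
    exact le_bot_iff.1 (hi ▸ hc.monotone (Fin.zero_le i))
  have hlast : ∀ t, a t ≤ c (Fin.last n) := fun t => by
    obtain ⟨i, hi⟩ := hamem t
    exact hi ▸ hc.monotone (Fin.le_last i)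
  have hctop : c (Fin.last n) = ⊤ := by
    obtain ⟨t₀, ht₀⟩ : ∃ t₀, ∀ t ≤ t₀, a t = c (Fin.last n) := by
      rcases hcmem (Fin.last n) with h | ⟨t₀, h⟩
      · exact ⟨0, fun t _ => by rw [h]; exact le_bot_iff.1 (h ▸ hlast t)⟩
      · exact ⟨t₀, fun t ht => le_antisymm (hlast t) (h ▸ hanti ht)⟩
    by_contra hne
    have hmax : ∀ t ≤ t₀, -(Z ⊤).re - t * (Z ⊤).im ≤
        -(Z (c (Fin.last n))).re - t * (Z (c (Fin.last n))).im := fun t ht =>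
      ht₀ t ht ▸ (ha t ⊤).le
    rcases hlt _ _ (lt_top_iff_ne_top.2 hne) with h | ⟨h, h'⟩
    · set x := (Z ⊤).im - (Z (c (Fin.last n))).im with hx
      have hxpos : 0 < x := sub_pos.2 h
      set y := (Z (c (Fin.last n))).re - (Z ⊤).re with hy
      have := hmax (min t₀ ((y - 1) / x)) (min_le_left _ _)
      have h2 : min t₀ ((y - 1) / x) * x ≤ y - 1 := by
        calc _ ≤ (y - 1) / x * x := by gcongr; exact min_le_right _ _
          _ = _ := by field_simp
      nlinarith
    · have := hmax t₀ le_rfl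
      rw [h] at this
      linarith
  have hsucc : ∀ i : Fin n, ∃ t, a t = c i.succ := fun i => by
    refine (hcmem _).resolve_left fun h => ?_
    have : c i.castSucc < c i.succ := hc (Fin.castSucc_lt_succ)
    simp [h] at this
  have hconsec : ∀ (i : Fin n) t, c i.castSucc < a t → a t ≤ c i.succ → a t = c i.succ := by
    intro i t h h'
    obtain ⟨j, hj⟩ := hamem t
    rw [← hj] at h h' ⊢
    rw [hc.lt_iff_lt] at h
    rw [hc.le_iff_le] at h'
    exact congrArg c (le_antisymm h' (Fin.castSucc_lt_iff_succ_le.1 h))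
  have hkey : ∀ i : Fin n,
      ((Z (c i.succ) - Z (c i.castSucc)).im = 0 ∧ (Z (c i.succ) - Z (c i.castSucc)).re < 0 ∧
        c i.castSucc = ⊥) ∨
      (0 < (Z (c i.succ) - Z (c i.castSucc)).im ∧
        a (-(Z (c i.succ) - Z (c i.castSucc)).re / (Z (c i.succ) - Z (c i.castSucc)).im)
          = c i.succ ∧ ∃ t, a t = c i.castSucc) := by
    intro i
    have hci : c i.castSucc < c i.succ := hc (Fin.castSucc_lt_succ)
    obtain ⟨t₂, ht₂⟩ := hsucc i
    by_cases hra : ∃ t, a t = c i.castSucc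
    · right
      obtain ⟨t₁, ht₁⟩ := hra
      have hd : 0 < (Z (c i.succ) - Z (c i.castSucc)).im := by
        rw [Complex.sub_im, sub_pos]
        rcases hlt _ _ hci with h | ⟨h, h'⟩
        · exact h
        · have := (ha t₁ (c i.succ)).le
          rw [ht₁, h] at this
          linarith
      refine ⟨hd, ?_, t₁, ht₁⟩
      set d := Z (c i.succ) - Z (c i.castSucc) with hdd
      set t₀ := -d.re / d.im with ht₀
      have htd : t₀ * d.im = -d.re := by rw [ht₀]; field_simp
      have hdre : d.re = (Z (c i.succ)).re - (Z (c i.castSucc)).re := by simp [hdd]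
      have hdim : d.im = (Z (c i.succ)).im - (Z (c i.castSucc)).im := by simp [hdd]
      have h2 : t₂ ≤ t₀ := by
        have := (ha t₂ (c i.castSucc)).le
        rw [ht₂] at this
        refine le_of_mul_le_mul_right ?_ hd
        rw [htd, hdre, hdim]
        linarith
      have h1 : t₀ ≤ t₁ := by
        have := (ha t₁ (c i.succ)).le
        rw [ht₁] at this
        refine le_of_mul_le_mul_right ?_ hd
        rw [htd, hdre, hdim]
        linarith
      have hle : a t₀ ≤ c i.succ := ht₂ ▸ hanti h2
      have hge : c i.castSucc ≤ a t₀ := ht₁ ▸ hanti h1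
      refine hconsec i t₀ (lt_of_le_of_ne hge fun heq => ?_) hle
      have := ha t₀ (c i.succ)
      rw [← heq] at this
      unfold lexLE at this
      rw [hdre, hdim] at htd
      rw [hdim] at hd
      rcases this with h | ⟨-, h⟩ <;> linarith
    · left
      have hbot := (hcmem i.castSucc).resolve_right hra
      have hra' : ∀ t, a t ≠ ⊥ := fun t h => hra ⟨t, h.trans hbot.symm⟩
      have hconst : ∀ t, t₂ ≤ t → a t = c i.succ := fun t ht =>
        hconsec i t (hbot ▸ bot_lt_iff_ne_bot.2 (hra' t)) (ht₂ ▸ hanti ht)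
      have hmax : ∀ t, t₂ ≤ t → 0 ≤ -(Z (c i.succ)).re - t * (Z (c i.succ)).im :=
        fun t ht => by
          have := (ha t ⊥).le
          rw [hconst t ht, h0] at this
          simpa using this
      have hzero : (Z (c i.succ)).im = 0 := by
        by_contra hne
        have hpos : 0 < (Z (c i.succ)).im := lt_of_le_of_ne (him _) (Ne.symm hne)
        set x := (Z (c i.succ)).im
        set y := -(Z (c i.succ)).re
        have := hmax (max t₂ ((y + 1) / x)) (le_max_left _ _)
        have h2 : y + 1 ≤ max t₂ ((y + 1) / x) * x := by
          calc y + 1 = (y + 1) / x * x := by field_simp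
            _ ≤ _ := by gcongr; exact le_max_right _ _
        linarith
      rw [hbot, h0, sub_zero]
      have := hlt _ _ hci
      rw [hbot, h0] at this
      exact ⟨hzero, by simpa [hzero] using this, rfl⟩
  refine ⟨n, c, hc, hc0, hctop, fun i B hAB hBC => ?_, fun i j hij => ?_⟩
  · rcases hkey i with ⟨h1, h2, h3⟩ | ⟨h1, h2, h3⟩
    · rw [h3, h0] at h1 ⊢
      have := himle _ _ hBC
      simp only [sub_zero] at h1 ⊢
      rw [slopeLE, h1, le_antisymm (this.trans_eq h1) (him B)]
      simp
    · unfold slopeLE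
      have := (ha (-(Z (c i.succ) - Z (c i.castSucc)).re /
        (Z (c i.succ) - Z (c i.castSucc)).im) B).le
      rw [h2] at this
      have htd : (-(Z (c i.succ) - Z (c i.castSucc)).re /
        (Z (c i.succ) - Z (c i.castSucc)).im) * (Z (c i.succ) - Z (c i.castSucc)).im
          = -(Z (c i.succ) - Z (c i.castSucc)).re := by field_simp
      generalize -(Z (c i.succ) - Z (c i.castSucc)).re /
        (Z (c i.succ) - Z (c i.castSucc)).im = t at *
      simp only [Complex.sub_re, Complex.sub_im] at *
      have hb : 0 ≤ (Z B).re - (Z (c i.castSucc)).re + t * ((Z B).im - (Z (c i.castSucc)).im) := by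
        linarith
      linear_combination mul_nonneg hb h1.le + ((Z B).im - (Z (c i.castSucc)).im) * htd
  · have hle : c i.succ ≤ c j.castSucc := hc.monotone (Fin.succ_le_castSucc_iff.2 hij)
    have hbi : c i.castSucc < c i.succ := hc (Fin.castSucc_lt_succ)
    have hbj : c j.castSucc < c j.succ := hc (Fin.castSucc_lt_succ)
    rcases hkey j with ⟨-, -, h⟩ | ⟨j1, j2, -⟩
    · exact absurd (bot_le.trans_lt (hbi.trans_le hle)) (by simp [h])
    · rcases hkey i with ⟨i1, i2, -⟩ | ⟨i1, i2, -⟩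
      · rw [slopeLT, i1]
        nlinarith
      · have hlt' : -(Z (c j.succ) - Z (c j.castSucc)).re / (Z (c j.succ) - Z (c j.castSucc)).im
            < -(Z (c i.succ) - Z (c i.castSucc)).re / (Z (c i.succ) - Z (c i.castSucc)).im := by
          by_contra! hcon
          have := hanti hcon
          rw [i2, j2] at this
          exact absurd (hbj.trans_le (this.trans hle)) (lt_irrefl _)
        rw [div_lt_div_iff₀ j1 i1] at hlt'
        rw [slopeLT]
        linarith

end Lattice

/-- A weak stability function: additive on monomorphisms, with values in the closed upper
half-plane whose boundary points have non-positive real part. -/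
structure IsWeakStabilityFunction (Z : C → ℂ) : Prop where
  add_cokernel : ∀ (X Y : C) (f : X ⟶ Y), Mono f → Z Y = Z X + Z (cokernel f)
  im_nonneg : ∀ X : C, 0 ≤ (Z X).im
  re_nonpos : ∀ X : C, (Z X).im = 0 → (Z X).re ≤ 0

namespace IsWeakStabilityFunction

variable {Z : C → ℂ}

theorem eq_zero_of_isZero (hZ : IsWeakStabilityFunction Z) {X : C} (hX : IsZero X) : Z X = 0 := by
  have h1 := hZ.add_cokernel X X (𝟙 X) inferInstance
  have h2 := hZ.add_cokernel X (cokernel (𝟙 X)) 0 ⟨fun _ _ _ => hX.eq_of_tgt _ _⟩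
  rw [left_eq_add.1 h1] at h2
  have hre := congrArg Complex.re h2
  have him := congrArg Complex.im h2
  simp only [Complex.add_re, Complex.add_im, Complex.zero_re, Complex.zero_im] at hre him
  have a1 := hZ.im_nonneg X
  have a2 := hZ.im_nonneg (cokernel (0 : X ⟶ cokernel (𝟙 X)))
  have b1 := hZ.re_nonpos X (by linarith)
  have b2 := hZ.re_nonpos (cokernel (0 : X ⟶ cokernel (𝟙 X))) (by linarith)
  apply Complex.ext <;> simp <;> linarith

theorem eq_of_iso (hZ : IsWeakStabilityFunction Z) {X Y : C} (e : X ≅ Y) : Z X = Z Y := by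
  rw [hZ.add_cokernel X Y e.hom inferInstance,
    hZ.eq_zero_of_isZero (isZero_cokernel_of_epi e.hom), add_zero]

theorem eq_kernel_add_of_epi (hZ : IsWeakStabilityFunction Z) {X Y : C} (g : X ⟶ Y) [Epi g] :
    Z X = Z (kernel g) + Z Y := by
  rw [hZ.add_cokernel _ _ (kernel.ι g) inferInstance]
  congr 1
  exact hZ.eq_of_iso ((cokernelIsCokernel (kernel.ι g)).coconePointUniqueUpToIso
    (Abelian.epiIsCokernelOfKernel _ (limit.isLimit _)))

theorem add_cokernel_eq_kernel_add (hZ : IsWeakStabilityFunction Z) {X Y : C} (g : X ⟶ Y) :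
    Z X + Z (cokernel g) = Z (kernel g) + Z Y := by
  have h1 := hZ.eq_kernel_add_of_epi (Abelian.factorThruImage g)
  have h2 := hZ.eq_kernel_add_of_epi (cokernel.π g)
  have h3 := hZ.eq_of_iso
    (kernelCompMono (Abelian.factorThruImage g) (Abelian.image.ι g)).symm
  have h4 := hZ.eq_of_iso (kernelIsoOfEq (Abelian.image.fac g))
  rw [h1, h2, h3, h4]
  abel

end IsWeakStabilityFunction

/-- The subobjects of `F` represented by an object of `P`. -/
def SubobjectIn (P : Set C) (F : C) : Type (max u v) :=
  {A : Subobject F // ∃ X ∈ P, ∃ (ι : X ⟶ F) (_ : Mono ι), Subobject.mk ι = A}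

namespace SubobjectIn

variable {P : Set C} {F : C}

instance : PartialOrder (SubobjectIn P F) := inferInstanceAs (PartialOrder (Subtype _))

/-- The element of `SubobjectIn P F` given by a monomorphism out of an object of `P`. -/
def mk {X : C} (hX : X ∈ P) (ι : X ⟶ F) [Mono ι] : SubobjectIn P F :=
  ⟨Subobject.mk ι, X, hX, ι, inferInstance, rfl⟩

theorem exists_eq_mk (A : SubobjectIn P F) :
    ∃ (X : C) (hX : X ∈ P) (ι : X ⟶ F) (_ : Mono ι), A = mk hX ι := by
  obtain ⟨A, X, hX, ι, hι, rfl⟩ := A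
  exact ⟨X, hX, ι, hι, rfl⟩

theorem mk_le_mk {X Y : C} {hX : X ∈ P} {hY : Y ∈ P} {ι : X ⟶ F} {κ : Y ⟶ F} [Mono ι] [Mono κ]
    (g : X ⟶ Y) (w : g ≫ κ = ι) : mk hX ι ≤ mk hY κ :=
  Subobject.mk_le_mk_of_comm g w

/-- The bounds of `SubobjectIn P F`, when `P` contains the zero objects and `F`. -/
noncomputable abbrev boundedOrder (hP0 : ∀ X : C, IsZero X → X ∈ P) (hF : F ∈ P) :
    BoundedOrder (SubobjectIn P F) where
  bot := ⟨⊥, _, hP0 _ (isZero_zero C), 0, inferInstance, Subobject.bot_eq_zero.symm⟩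
  top := ⟨⊤, _, hF, 𝟙 F, inferInstance, (Subobject.top_eq_id F).symm⟩
  bot_le A := (bot_le : ⊥ ≤ A.1)
  le_top A := (le_top : A.1 ≤ ⊤)

/-- The value of `Z` on a subobject. -/
noncomputable def value (Z : C → ℂ) (A : SubobjectIn P F) : ℂ := Z (A.1 : C)

variable {Z : C → ℂ}

theorem value_mk (hZ : IsWeakStabilityFunction Z) {X : C} (hX : X ∈ P) (ι : X ⟶ F) [Mono ι] :
    (mk hX ι).value Z = Z X :=
  hZ.eq_of_iso (Subobject.underlyingIso ι)

theorem range_value (hZ : IsWeakStabilityFunction Z) : Set.range (value (P := P) (F := F) Z) =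
    {z : ℂ | ∃ (A : C) (ι : A ⟶ F), Mono ι ∧ A ∈ P ∧ z = Z A} := by
  ext z
  constructor
  · rintro ⟨A, rfl⟩
    obtain ⟨X, hX, ι, _, rfl⟩ := A.exists_eq_mk
    exact ⟨X, ι, inferInstance, hX, value_mk hZ hX ι⟩
  · rintro ⟨X, ι, _, hX, rfl⟩
    exact ⟨mk hX ι, value_mk hZ hX ι⟩

theorem value_modular (hZ : IsWeakStabilityFunction Z) (hF : F ∈ P)
    (hPker : ∀ (X Y : C), X ∈ P → Y ∈ P → ∀ f : X ⟶ Y, kernel f ∈ P)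
    (hPcoker : ∀ (X Y : C), X ∈ P → Y ∈ P → ∀ f : X ⟶ Y, cokernel f ∈ P)
    (A B : SubobjectIn P F) :
    ∃ I J : SubobjectIn P F, I ≤ A ∧ I ≤ B ∧ A ≤ J ∧ B ≤ J ∧
      I.value Z + J.value Z = A.value Z + B.value Z := by
  obtain ⟨X, hX, ι, _, rfl⟩ := A.exists_eq_mk
  obtain ⟨Y, hY, κ, _, rfl⟩ := B.exists_eq_mk
  have hQ := hPcoker _ _ hY hF κ
  let g := ι ≫ cokernel.π κ
  let q := cokernel.π κ ≫ cokernel.π g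
  have hq := hPcoker _ _ hX hQ g
  refine ⟨mk (hPker _ _ hX hQ g) (kernel.ι g ≫ ι), mk (hPker _ _ hF hq q) (kernel.ι q),
    mk_le_mk (kernel.ι g) rfl,
    mk_le_mk (Abelian.monoLift κ (kernel.ι g ≫ ι) ?_) (Abelian.monoLift_comp _ _ _),
    mk_le_mk (kernel.lift q ι ?_) (kernel.lift_ι _ _ _),
    mk_le_mk (kernel.lift q κ ?_) (kernel.lift_ι _ _ _), ?_⟩
  · rw [Category.assoc]
    exact kernel.condition g
  · rw [← Category.assoc]
    exact cokernel.condition g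
  · simp [q]
  · simp only [value_mk hZ]
    have h1 := hZ.add_cokernel_eq_kernel_add g
    have h2 := hZ.eq_kernel_add_of_epi q
    have h3 := hZ.add_cokernel _ _ κ inferInstance
    linear_combination h3 - h1 - h2

theorem value_lt (hZ : IsWeakStabilityFunction Z)
    (hPcoker : ∀ (X Y : C), X ∈ P → Y ∈ P → ∀ f : X ⟶ Y, cokernel f ∈ P)
    (hstab : ∀ F ∈ P, ¬ IsZero F → (Z F).im = 0 → (Z F).re < 0)
    (A B : SubobjectIn P F) (h : A < B) :
    (A.value Z).im < (B.value Z).im ∨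
      ((A.value Z).im = (B.value Z).im ∧ (B.value Z).re < (A.value Z).re) := by
  obtain ⟨X, hX, ι, _, rfl⟩ := A.exists_eq_mk
  obtain ⟨Y, hY, κ, _, rfl⟩ := B.exists_eq_mk
  have hle : Subobject.mk ι ≤ Subobject.mk κ := h.le
  let f := Subobject.ofMkLEMk ι κ hle
  have hne : ¬ IsZero (cokernel f) := fun h0 => by
    have : Epi f := Preadditive.epi_of_isZero_cokernel f h0
    have : IsIso f := isIso_of_mono_of_epi f
    refine h.not_ge (mk_le_mk (inv f) ?_)
    rw [IsIso.inv_comp_eq]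
    exact (Subobject.ofMkLEMk_comp hle).symm
  rw [value_mk hZ, value_mk hZ, hZ.add_cokernel _ _ f inferInstance]
  rcases (hZ.im_nonneg (cokernel f)).eq_or_lt with h0 | h0
  · right
    simp [← h0, hstab _ (hPcoker _ _ hX hY f) hne h0.symm]
  · left
    simp [h0]

end SubobjectIn

/-- Semistability of a quotient of subobjects, in terms of intermediate subobjects. -/
theorem semistableIn_cokernel {Z : C → ℂ} (hZ : IsWeakStabilityFunction Z) {P : Set C}
    (hPker : ∀ (X Y : C), X ∈ P → Y ∈ P → ∀ f : X ⟶ Y, kernel f ∈ P)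
    (hPcoker : ∀ (X Y : C), X ∈ P → Y ∈ P → ∀ f : X ⟶ Y, cokernel f ∈ P)
    {X Y : C} (hX : X ∈ P) (hY : Y ∈ P) (f : X ⟶ Y) [Mono f] (hf : ¬ IsIso f)
    (h : ∀ B ∈ P, ∀ (a : X ⟶ B) (b : B ⟶ Y), Mono b → a ≫ b = f →
      slopeLE (Z B - Z X) (Z Y - Z X)) :
    SemistableIn Z P (cokernel f) := by
  refine ⟨hPcoker _ _ hX hY f, fun h0 => hf ?_, fun A ι _ hA _ => ?_⟩
  · have : Epi f := Preadditive.epi_of_isZero_cokernel f h0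
    exact isIso_of_mono_of_epi f
  have hQ := hPcoker _ _ hA (hPcoker _ _ hX hY f) ι
  let q := cokernel.π f ≫ cokernel.π ι
  have key := h _ (hPker _ _ hY hQ q) (kernel.lift q f (by simp [q])) (kernel.ι q)
    inferInstance (kernel.lift_ι _ _ _)
  have h1 := hZ.eq_kernel_add_of_epi q
  have h2 := hZ.add_cokernel _ _ f inferInstance
  have h3 := hZ.add_cokernel _ _ ι inferInstance
  convert key using 1
  · linear_combination h1 - h2 - h3
  · linear_combination -h2

/-- Inducing Harder–Narasimhan filtrations (Lemma 5.4 of the paper): let `Z` be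
a weak stability function on the abelian category `C` for which HN filtrations
exist, and let `P` be the class of objects of a full abelian subcategory whose
inclusion is exact (encoded: `P` contains zero objects and is closed under
kernels and cokernels). Suppose `Z` restricts to a stability function on `P`,
and every nonzero object of `P` has Harder–Narasimhan polygon (with respect to
subobjects in `P`) which is finite polyhedral on the left. Then every object of
`P` admits an HN filtration within `P`. -/
theorem stmt15 (Z : C → ℂ)
    (hZadd : ∀ (X Y : C) (f : X ⟶ Y), Mono f → Z Y = Z X + Z (cokernel f))
    (hZim : ∀ X : C, 0 ≤ (Z X).im)
    (hZre : ∀ X : C, (Z X).im = 0 → (Z X).re ≤ 0)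
    (hHNC : ∀ E : C, HasHNFiltrationIn Z Set.univ E)
    (P : Set C)
    (hP0 : ∀ X : C, IsZero X → X ∈ P)
    (hPker : ∀ (X Y : C), X ∈ P → Y ∈ P → ∀ f : X ⟶ Y, kernel f ∈ P)
    (hPcoker : ∀ (X Y : C), X ∈ P → Y ∈ P → ∀ f : X ⟶ Y, cokernel f ∈ P)
    (hstab : ∀ F ∈ P, ¬ IsZero F → (Z F).im = 0 → (Z F).re < 0)
    (hpoly : ∀ F ∈ P, ¬ IsZero F → ∃ s : Finset ℂ,
      convexHull ℝ {z : ℂ | ∃ (A : C) (ι : A ⟶ F), Mono ι ∧ A ∈ P ∧ z = Z A}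
          ∩ {z : ℂ | 0 ≤ (Z F).re * z.im - (Z F).im * z.re}
        = convexHull ℝ (s : Set ℂ)) :
    ∀ F ∈ P, HasHNFiltrationIn Z P F := by
  intro F hF
  have hZ : IsWeakStabilityFunction Z := ⟨hZadd, hZim, hZre⟩
  by_cases hF0 : IsZero F
  · exact ⟨0, fun _ => F, fun i => i.elim0, hF0, ⟨Iso.refl F⟩, fun _ => hF,
      fun i => i.elim0, fun i => i.elim0, fun i => i.elim0⟩
  let : BoundedOrder (SubobjectIn P F) := SubobjectIn.boundedOrder hP0 hF
  obtain ⟨s, hs⟩ := hpoly F hF hF0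
  have hbot : (⊥ : SubobjectIn P F).value Z = 0 :=
    (hZ.eq_of_iso Subobject.botCoeIsoZero).trans (hZ.eq_zero_of_isZero (isZero_zero C))
  have htop : (⊤ : SubobjectIn P F).value Z = Z F := hZ.eq_of_iso (asIso (⊤ : Subobject F).arrow)
  rw [← SubobjectIn.range_value hZ, ← htop] at hs
  obtain ⟨n, c, hc, hc0, hcn, hss, hdec⟩ := exists_hn_chain hbot
    (SubobjectIn.value_modular hZ hF hPker hPcoker)
    (SubobjectIn.value_lt hZ hPcoker hstab) hs
  choose X hX ι hι hcX using fun i => (c i).exists_eq_mk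
  have hval : ∀ i, (c i).value Z = Z (X i) := fun i => by
    rw [hcX i, SubobjectIn.value_mk hZ]
  have hmk : ∀ i, Subobject.mk (ι i) = (c i).1 := fun i => congrArg Subtype.val (hcX i).symm
  have hle : ∀ i : Fin n, Subobject.mk (ι i.castSucc) ≤ Subobject.mk (ι i.succ) := fun i => by
    rw [hmk, hmk]
    exact hc.monotone (Fin.castSucc_lt_succ (i := i)).le
  let f : ∀ i : Fin n, X i.castSucc ⟶ X i.succ := fun i => Subobject.ofMkLEMk _ _ (hle i)
  have hfι : ∀ i, f i ≫ ι i.succ = ι i.castSucc := fun i => Subobject.ofMkLEMk_comp (hle i)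
  have hfmono : ∀ i, Mono (f i) := fun i => inferInstanceAs (Mono (Subobject.ofMkLEMk _ _ _))
  have hZf : ∀ i, Z (cokernel (f i)) = (c i.succ).value Z - (c i.castSucc).value Z :=
    fun i => by
      rw [hval, hval, hZ.add_cokernel _ _ (f i) (hfmono i)]
      ring
  refine ⟨n, X, f, ?_, ?_, hX, hfmono, fun i => ?_, fun i j hij => ?_⟩
  · have h0 : Subobject.mk (ι 0) = ⊥ := by
      rw [hmk, hc0]
      rfl
    exact IsZero.of_mono_eq_zero (ι 0) (Subobject.mk_eq_bot_iff_zero.1 h0)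
  · have h1 : Subobject.mk (ι (Fin.last n)) = ⊤ := by
      rw [hmk, hcn]
      rfl
    have := (Subobject.isIso_iff_mk_eq_top _).2 h1
    exact ⟨asIso (ι (Fin.last n))⟩
  · refine semistableIn_cokernel hZ hPker hPcoker (hX _) (hX _) (f i) (fun hiso => ?_)
      fun B hB a b _ hab => ?_
    · refine (hc (Fin.castSucc_lt_succ (i := i))).not_ge ?_
      rw [hcX, hcX i.castSucc]
      exact SubobjectIn.mk_le_mk (inv (f i)) (by rw [IsIso.inv_comp_eq, hfι])
    · have := hss i (SubobjectIn.mk hB (b ≫ ι i.succ))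
        (by
          rw [hcX i.castSucc]
          exact SubobjectIn.mk_le_mk a (by rw [← hfι, ← hab, Category.assoc]))
        (by rw [hcX i.succ]; exact SubobjectIn.mk_le_mk b rfl)
      rwa [SubobjectIn.value_mk hZ, hval, hval] at this
  · rw [hZf, hZf]
    exact hdec i j hij
end
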